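/- arXiv:1405.6280 — 4 statements merged into one kernel-verified Lean document; each statement's English description precedes it below -/
import Mathlib

section
/- Let 𝓞 be the ring of integers of a number field and π a nonzero ideal of 𝓞. Then the reduction homomorphism SL(2,𝓞) → SL(2,𝓞/π) given by reducing each matrix entry modulo π is surjective. -/
open NumberField Matrix

/-- Semilocal rings have stable range one. -/
theorem IsCoprime.exists_isUnit_add_mul {S : Type*} [CommRing S] [Finite (MaximalSpectrum S)]
    {a b : S} (h : IsCoprime a b) : ∃ t : S, IsUnit (a + b * t) := by
  classical
  obtain ⟨t, ht⟩ := Ideal.pi_quotient_surjective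
    (I := fun m : MaximalSpectrum S => m.asIdeal)
    (fun m n hmn => Ideal.isCoprime_of_isMaximal fun e => hmn (MaximalSpectrum.ext e))
    (fun m => if a ∈ m.asIdeal then 1 else 0)
  refine ⟨t, ?_⟩
  by_contra hu
  obtain ⟨m, hm, hmem⟩ := exists_max_ideal_of_mem_nonunits hu
  have htm : Ideal.Quotient.mk m t = if a ∈ m then 1 else 0 :=
    ht ⟨m, hm⟩
  rw [← Ideal.Quotient.eq_zero_iff_mem, map_add, map_mul, htm] at hmem
  split_ifs at hmem with ha
  · rw [Ideal.Quotient.eq_zero_iff_mem.mpr ha, mul_one, zero_add,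
      Ideal.Quotient.eq_zero_iff_mem] at hmem
    obtain ⟨x, y, hxy⟩ := h
    exact hm.ne_top ((Ideal.eq_top_iff_one m).mpr
      (hxy ▸ m.add_mem (m.mul_mem_left x ha) (m.mul_mem_left y hmem)))
  · rw [mul_zero, add_zero, Ideal.Quotient.eq_zero_iff_mem] at hmem
    exact ha hmem

namespace Matrix.SpecialLinearGroup

/-- The element of `SL(2, R)` with the given entries. -/
def ofEntries {R : Type*} [CommRing R] (a b c d : R) (h : a * d - b * c = 1) :
    SpecialLinearGroup (Fin 2) R :=
  ⟨!![a, b; c, d], by rw [det_fin_two_of, h]⟩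

theorem coe_ofEntries {R : Type*} [CommRing R] (a b c d : R) (h : a * d - b * c = 1) :
    (ofEntries a b c d h : Matrix (Fin 2) (Fin 2) R) = !![a, b; c, d] :=
  rfl

theorem map_ofEntries {R S : Type*} [CommRing R] [CommRing S] (f : R →+* S) (a b c d : R)
    (h : a * d - b * c = 1) :
    map f (ofEntries a b c d h) =
      ofEntries (f a) (f b) (f c) (f d) (by simp only [← map_mul, ← map_sub, h, map_one]) := by
  ext i j
  fin_cases i <;> fin_cases j <;> rfl

/-- A surjection onto a semilocal ring induces a surjection on `SL(2)`. -/
theorem map_surjective_of_finite_maximalSpectrum {R S : Type*} [CommRing R] [CommRing S]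
    [Finite (MaximalSpectrum S)] {f : R →+* S} (hf : Function.Surjective f) :
    Function.Surjective (map (n := Fin 2) f) := by
  intro M
  have lower_mem (s : S) : ofEntries 1 0 s 1 (by ring) ∈ (map (n := Fin 2) f).range := by
    obtain ⟨r, rfl⟩ := hf s
    exact ⟨ofEntries 1 0 r 1 (by ring), by simp [map_ofEntries]⟩
  have upper_mem (s : S) : ofEntries 1 s 0 1 (by ring) ∈ (map (n := Fin 2) f).range := by
    obtain ⟨r, rfl⟩ := hf s
    exact ⟨ofEntries 1 r 0 1 (by ring), by simp [map_ofEntries]⟩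
  have weyl_mem (s : S) : ofEntries 0 1 (-1) s (by ring) ∈ (map (n := Fin 2) f).range := by
    obtain ⟨r, rfl⟩ := hf s
    exact ⟨ofEntries 0 1 (-1) r (by ring), by simp [map_ofEntries]⟩
  have hdet : M 0 0 * M 1 1 - M 0 1 * M 1 0 = 1 := by
    rw [← det_fin_two]
    exact M.det_coe
  obtain ⟨t, v, hv⟩ : ∃ t v, (M 0 0 + M 0 1 * t) * v = 1 := by
    obtain ⟨t, ht⟩ := IsCoprime.exists_isUnit_add_mul
      (a := M 0 0) (b := M 0 1) ⟨M 1 1, -M 1 0, by linear_combination hdet⟩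
    exact ⟨t, ht.exists_right_inv⟩
  obtain ⟨u, hu⟩ : ∃ u, u = M 0 0 + M 0 1 * t := ⟨_, rfl⟩
  obtain ⟨x, hx⟩ : ∃ x, u * x + M 0 1 = 1 :=
    ⟨v * (1 - M 0 1), by rw [hu]; linear_combination (1 - M 0 1) * hv⟩
  have hmul : M * ofEntries 1 0 t 1 (by ring) * ofEntries 1 x 0 1 (by ring) *
      ofEntries 1 0 (-u) 1 (by ring) =
      ofEntries 0 1 (-1) ((M 1 0 + M 1 1 * t) * x + M 1 1) (by ring) := by
    ext i j
    fin_cases i <;> fin_cases j <;>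
      simp [coe_mul, coe_ofEntries, Matrix.mul_apply, Fin.sum_univ_two]
    · linear_combination -u * hx - (1 - u * x) * hu
    · linear_combination hx - x * hu
    · linear_combination (-(M 1 0 + M 1 1 * t)) * hx - hdet - M 1 1 * hu
  have hmem := weyl_mem ((M 1 0 + M 1 1 * t) * x + M 1 1)
  rw [← hmul, Subgroup.mul_mem_cancel_right _ (lower_mem _),
    Subgroup.mul_mem_cancel_right _ (upper_mem _),
    Subgroup.mul_mem_cancel_right _ (lower_mem _)] at hmem
  exact hmem

end Matrix.SpecialLinearGroup

/-- **Surjectivity of reduction.** Let `𝓞` be the ring of integers of a number field `K`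
and `π` a nonzero ideal of `𝓞`. Then the reduction homomorphism
`SL(2, 𝓞) → SL(2, 𝓞/π)`, given by reducing each matrix entry modulo `π`, is surjective. -/
theorem reduction_surjective (K : Type*) [Field K] [NumberField K]
    (π : Ideal (𝓞 K)) (hπ : π ≠ ⊥) :
    Function.Surjective
      (Matrix.SpecialLinearGroup.map (n := Fin 2) (Ideal.Quotient.mk π)) := by
  have : Finite (𝓞 K ⧸ π) := Ideal.finiteQuotientOfFreeOfNeBot π hπ
  exact SpecialLinearGroup.map_surjective_of_finite_maximalSpectrum Ideal.Quotient.mk_surjective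
end

section
/- Let 𝓞 be the ring of integers of a number field and π a nonzero proper ideal of 𝓞. Then the index of the principal congruence subgroup Γ(π) in Γ = SL(2,𝓞) satisfies [Γ : Γ(π)] = N(π)³ · ∏_{P ∣ π} (1 − N(P)⁻²), where the product runs over the distinct prime ideals P dividing π and N denotes the absolute norm of an ideal (the equality being an identity of rational numbers). -/
open NumberField Matrix

section StableRange

/-- Stable range one, for pairs that generate the unit ideal: a coprime pair `(a, c)` can be
reduced to a unit `a + t * c`. -/
def HasUnitShift (R : Type*) [CommRing R] : Prop :=
  ∀ a c : R, IsCoprime a c → ∃ t : R, IsUnit (a + t * c)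

theorem HasUnitShift.of_isLocalHom {R F : Type*} [CommRing R] [Field F] (f : R →+* F)
    [IsLocalHom f] : HasUnitShift R := by
  intro a c h
  by_cases ha : IsUnit a
  · exact ⟨0, by simpa using ha⟩
  · refine ⟨1, isUnit_of_map_unit f _ (isUnit_iff_ne_zero.mpr ?_)⟩
    have hfa : f a = 0 := by
      by_contra hne
      exact ha (isUnit_of_map_unit f _ (isUnit_iff_ne_zero.mpr hne))
    obtain ⟨x, y, hxy⟩ := h.map f
    rw [hfa, mul_zero, zero_add] at hxy
    simpa [hfa] using right_ne_zero_of_mul_eq_one hxy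

theorem HasUnitShift.pi {ι : Type*} {R : ι → Type*} [∀ i, CommRing (R i)]
    (h : ∀ i, HasUnitShift (R i)) : HasUnitShift (∀ i, R i) := by
  intro a c hac
  choose t ht using fun i => h i (a i) (c i) (hac.map (Pi.evalRingHom R i))
  exact ⟨t, Pi.isUnit_iff.mpr ht⟩

theorem HasUnitShift.of_ringEquiv {R S : Type*} [CommRing R] [CommRing S] (e : R ≃+* S)
    (h : HasUnitShift S) : HasUnitShift R := by
  intro a c hac
  obtain ⟨t, ht⟩ := h (e a) (e c) (hac.map (e : R →+* S))
  refine ⟨e.symm t, ?_⟩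
  simpa using ht.map e.symm

end StableRange

namespace Matrix.SpecialLinearGroup

theorem map_transvection {n R S : Type*} [DecidableEq n] [Fintype n] [CommRing R] [CommRing S]
    (f : R →+* S) {i j : n} (hij : i ≠ j) (b : R) :
    map f (transvection hij b) = transvection hij (f b) := by
  ext k l
  simp [transvection_coe, Matrix.one_apply, Matrix.single_apply, apply_ite f]

/-- Reduction is surjective on `SL₂` when the target has stable range one: there `SL₂` is
generated by transvections, which lift. -/
theorem map_surjective_of_hasUnitShift {R S : Type*} [CommRing R] [CommRing S] {f : R →+* S}
    (hf : Function.Surjective f) (hS : HasUnitShift S) :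
    Function.Surjective (map (n := Fin 2) f) := by
  have hmem {i j : Fin 2} (hij : i ≠ j) (b : S) :
      transvection hij b ∈ (map (n := Fin 2) f).range := by
    obtain ⟨b, rfl⟩ := hf b
    exact ⟨_, map_transvection f hij b⟩
  intro A
  obtain ⟨t, ⟨u, hu⟩⟩ := hS (A 0 0) (A 1 0) (A.isCoprime_col 0)
  have h01 : (0 : Fin 2) ≠ 1 := zero_ne_one
  have h10 : (1 : Fin 2) ≠ 0 := one_ne_zero
  set s : S := (1 - A 1 0) * (u⁻¹ : Sˣ)
  set B := transvection h10 (-1 : S) * (transvection h01 (1 - (u : S)) *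
    (transvection h10 s * (transvection h01 t * A)))
  have hs : s * (A 0 0 + t * A 1 0) = 1 - A 1 0 := by
    simp [s, ← hu, mul_assoc]
  have hB0 : B 0 0 = 1 := by
    simp [B, transvection_coe, Matrix.mul_apply, Fin.sum_univ_two, Matrix.single_apply]
    linear_combination (1 - (u : S)) * hs - hu
  have hB1 : B 1 0 = 0 := by
    simp [B, transvection_coe, Matrix.mul_apply, Fin.sum_univ_two, Matrix.single_apply]
    linear_combination (u : S) * hs + hu
  have hB : B = transvection h01 (B 0 1) := by
    have hdet := B.det_coe
    rw [Matrix.det_fin_two, hB0, hB1] at hdet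
    ext i j
    fin_cases i <;> fin_cases j <;>
      simp_all [transvection_coe]
  have hmemB : B ∈ (map (n := Fin 2) f).range := hB ▸ hmem h01 _
  exact MonoidHom.mem_range.mp
    (by simpa only [B, Subgroup.mul_mem_cancel_left _ (hmem _ _)] using hmemB)

/-- Matrices in `SL₂` over a finite product are families of matrices in `SL₂`. -/
def piEquiv (n : Type*) [DecidableEq n] [Fintype n] {ι : Type*} (R : ι → Type*)
    [∀ i, CommRing (R i)] :
    SpecialLinearGroup n (∀ i, R i) ≃ ∀ i, SpecialLinearGroup n (R i) where
  toFun A i := map (Pi.evalRingHom R i) A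
  invFun A := ⟨Matrix.of fun k l i => A i k l, by
    funext i
    have := (Pi.evalRingHom R i).map_det (Matrix.of fun k l i => A i k l)
    exact this.trans (A i).det_coe⟩
  left_inv A := rfl
  right_inv A := rfl

/-- Coordinates on the elements of `SL₂` with invertible upper left entry. -/
noncomputable def isUnitEquiv (R : Type*) [CommRing R] :
    {A : SpecialLinearGroup (Fin 2) R // IsUnit (A 0 0)} ≃ Rˣ × R × R where
  toFun A := (A.2.unit, A.1 0 1, A.1 1 0)
  invFun x := ⟨⟨!![(x.1 : R), x.2.1; x.2.2, (x.1⁻¹ : Rˣ) * (1 + x.2.1 * x.2.2)], by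
    simp [Matrix.det_fin_two]⟩, x.1.isUnit⟩
  left_inv A := by
    obtain ⟨A, hA⟩ := A
    have hdet := A.det_coe
    rw [Matrix.det_fin_two] at hdet
    have h : (hA.unit⁻¹ : Rˣ) * (1 + A 0 1 * A 1 0) = A 1 1 := by
      rw [Units.inv_mul_eq_iff_eq_mul]
      simp only [IsUnit.unit_spec]
      linear_combination -hdet
    ext i j
    fin_cases i <;> fin_cases j <;> simp [h]
  right_inv x := by
    ext <;> simp

/-- Coordinates on the elements of `SL₂` with non-invertible upper left entry, over a ring whose
non-units are the kernel of a homomorphism to a field. -/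
noncomputable def notIsUnitEquiv {R F : Type*} [CommRing R] [Field F] (f : R →+* F) [IsLocalHom f] :
    {A : SpecialLinearGroup (Fin 2) R // ¬ IsUnit (A 0 0)} ≃ {a : R // ¬ IsUnit a} × Rˣ × R where
  toFun A := (⟨A.1 0 0, A.2⟩, IsUnit.unit (a := A.1 1 0) (by
    have hdet := congrArg f A.1.det_coe
    have h0 : f (A.1 0 0) = 0 := by
      by_contra hne
      exact A.2 (isUnit_of_map_unit f _ (isUnit_iff_ne_zero.mpr hne))
    refine isUnit_of_map_unit f _ (isUnit_iff_ne_zero.mpr fun h1 => ?_)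
    rw [Matrix.det_fin_two, map_sub, map_mul, map_mul, h0, h1] at hdet
    simp at hdet), A.1 1 1)
  invFun x := ⟨⟨!![x.1.1, (x.2.1⁻¹ : Rˣ) * (x.1.1 * x.2.2 - 1); (x.2.1 : R), x.2.2], by
    rw [Matrix.det_fin_two_of, mul_right_comm, Units.inv_mul]
    ring⟩, x.1.2⟩
  left_inv A := by
    obtain ⟨A, hA⟩ := A
    have hdet := A.det_coe
    rw [Matrix.det_fin_two] at hdet
    ext i j
    fin_cases i <;> fin_cases j <;> simp
    rw [Units.inv_mul_eq_iff_eq_mul]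
    simp only [IsUnit.unit_spec]
    linear_combination hdet
  right_inv x := by
    ext <;> simp

theorem card_fin_two_of_isLocalHom {R F : Type*} [CommRing R] [Finite R] [Field F] (f : R →+* F)
    [IsLocalHom f] (hf : Function.Surjective f) :
    (Nat.card (SpecialLinearGroup (Fin 2) R) : ℚ) =
      (Nat.card R : ℚ) ^ 3 * (1 - ((Nat.card F : ℚ) ^ 2)⁻¹) := by
  classical
  have : Finite F := .of_surjective f hf
  have hnon : Nat.card {a : R // ¬ IsUnit a} * Nat.card F = Nat.card R := by
    have h := f.toAddMonoidHom.ker.card_mul_index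
    rw [AddSubgroup.index_ker, AddMonoidHom.range_eq_top.mpr hf, AddSubgroup.card_top] at h
    rw [← h]
    congr 1
    refine Nat.card_congr (Equiv.subtypeEquivRight fun a => ?_)
    rw [← isUnit_map_iff f, isUnit_iff_ne_zero, not_not]
    rfl
  have hunit : Nat.card Rˣ + Nat.card {a : R // ¬ IsUnit a} = Nat.card R := by
    have e : Rˣ ≃ {a : R // IsUnit a} := Submonoid.unitsTypeEquivIsUnitSubmonoid.toEquiv
    rw [Nat.card_congr e, ← Nat.card_sum]
    exact Nat.card_congr (Equiv.sumCompl _)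
  have hSL : Nat.card (SpecialLinearGroup (Fin 2) R) =
      Nat.card Rˣ * (Nat.card R * Nat.card R) +
        Nat.card {a : R // ¬ IsUnit a} * (Nat.card Rˣ * Nat.card R) := by
    rw [← Nat.card_congr (Equiv.sumCompl fun A : SpecialLinearGroup (Fin 2) R => IsUnit (A 0 0)),
      Nat.card_sum, Nat.card_congr (isUnitEquiv R), Nat.card_congr (notIsUnitEquiv f)]
    simp only [Nat.card_prod]
  have hF : (Nat.card F : ℚ) ≠ 0 := by exact_mod_cast Nat.card_pos.ne'
  rw [hSL]
  have hunit' : (Nat.card Rˣ : ℚ) = Nat.card R - Nat.card {a : R // ¬ IsUnit a} := by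
    rw [← hunit]; push_cast; ring
  push_cast
  rw [hunit', ← hnon]
  push_cast
  field_simp
  ring

end Matrix.SpecialLinearGroup

theorem Ideal.isLocalHom_factor_pow {R : Type*} [CommRing R] (P : Ideal R) {n : ℕ} (hn : n ≠ 0) :
    IsLocalHom (Ideal.Quotient.factor (Ideal.pow_le_self hn : P ^ n ≤ P)) where
  map_nonunit x hx := by
    obtain ⟨x, rfl⟩ := Ideal.Quotient.mk_surjective x
    rw [Ideal.Quotient.factor_mk] at hx
    exact (Ideal.Quotient.isUnit_mk_pow_iff_isUnit_mk P hn).mpr hx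

/-- **Index of the principal congruence subgroup.** Let `𝓞` be the ring of integers of a
number field and `π` a nonzero proper ideal of `𝓞`.  Then
`[Γ : Γ(π)] = N(π)³ · ∏_{P ∣ π} (1 − N(P)⁻²)`, where `Γ = SL(2, 𝓞)`, `Γ(π)` is the kernel of
the reduction map `SL(2,𝓞) → SL(2,𝓞/π)`, the product runs over the (finitely many) distinct
prime ideals `P` dividing `π`, and `N` is the absolute norm; the identity is read in `ℚ`. -/
theorem index_principal_congruence (K : Type*) [Field K] [NumberField K]
    (π : Ideal (𝓞 K)) (hπ : π ≠ ⊥) (hπ' : π ≠ ⊤)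
    (PF : Finset (Ideal (𝓞 K))) (hPF : ∀ P : Ideal (𝓞 K), P ∈ PF ↔ P.IsPrime ∧ P ∣ π) :
    (((MonoidHom.ker
        (Matrix.SpecialLinearGroup.map (n := Fin 2) (Ideal.Quotient.mk π))).index : ℚ)) =
      (Ideal.absNorm π : ℚ) ^ 3 *
        ∏ P ∈ PF, (1 - ((Ideal.absNorm P : ℚ) ^ 2)⁻¹) := by
  classical
  have hPF' : PF = (UniqueFactorizationMonoid.factors π).toFinset := by
    ext P
    rw [hPF, Multiset.mem_toFinset, UniqueFactorizationMonoid.factors_eq_normalizedFactors,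
      Ideal.mem_normalizedFactors_iff hπ, Ideal.dvd_iff_le]
  set e : Ideal (𝓞 K) → ℕ := fun P => (UniqueFactorizationMonoid.factors π).count P
  have he (P : PF) : e P ≠ 0 := by
    have := P.2
    simp only [hPF', Multiset.mem_toFinset] at this
    exact Multiset.count_ne_zero.mpr this
  have hne (P : PF) : (P : Ideal (𝓞 K)) ≠ ⊥ := by
    intro h
    exact hπ (le_bot_iff.mp (h ▸ Ideal.dvd_iff_le.mp ((hPF P).mp P.2).2))
  have hmax (P : PF) : (P : Ideal (𝓞 K)).IsMaximal := ((hPF P).mp P.2).1.isMaximal (hne P)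
  have φ : 𝓞 K ⧸ π ≃+* ∀ P : PF, 𝓞 K ⧸ (P : Ideal (𝓞 K)) ^ e P := by
    subst hPF'
    exact IsDedekindDomain.quotientEquivPiFactors hπ
  let F (P : PF) : Field (𝓞 K ⧸ (P : Ideal (𝓞 K))) := Ideal.Quotient.field _
  have hloc (P : PF) := Ideal.isLocalHom_factor_pow (P : Ideal (𝓞 K)) (he P)
  have hfin (P : PF) : Finite (𝓞 K ⧸ (P : Ideal (𝓞 K)) ^ e P) :=
    Ideal.finiteQuotientOfFreeOfNeBot _ (pow_ne_zero _ (hne P))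
  have hsurj := Matrix.SpecialLinearGroup.map_surjective_of_hasUnitShift
    (Ideal.Quotient.mk_surjective (I := π))
    (.of_ringEquiv φ (.pi fun P => .of_isLocalHom
      (Ideal.Quotient.factor (Ideal.pow_le_self (he P)))))
  have hcard : Nat.card (SpecialLinearGroup (Fin 2) (𝓞 K ⧸ π)) =
      ∏ P : PF, Nat.card (SpecialLinearGroup (Fin 2) (𝓞 K ⧸ (P : Ideal (𝓞 K)) ^ e P)) := by
    rw [← Nat.card_pi, ← Nat.card_congr (SpecialLinearGroup.piEquiv (Fin 2) _)]
    refine Nat.card_congr (Equiv.subtypeEquiv φ.toEquiv.mapMatrix fun A => ?_)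
    exact (map_eq_one_iff φ φ.injective).symm.trans (by rw [RingEquiv.map_det]; rfl)
  have hnorm : Ideal.absNorm π =
      ∏ P : PF, Nat.card (𝓞 K ⧸ (P : Ideal (𝓞 K)) ^ e P) := by
    rw [← Nat.card_pi, ← Nat.card_congr φ.toEquiv]
    rfl
  rw [Subgroup.index_ker, MonoidHom.range_eq_top.mpr hsurj, Subgroup.card_top, hcard, hnorm,
    ← Finset.prod_coe_sort PF]
  push_cast
  rw [← Finset.prod_pow, ← Finset.prod_mul_distrib]
  refine Finset.prod_congr rfl fun P _ => ?_
  exact SpecialLinearGroup.card_fin_two_of_isLocalHom (F := 𝓞 K ⧸ (P : Ideal (𝓞 K)))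
    (Ideal.Quotient.factor (Ideal.pow_le_self (he P))) (Ideal.Quotient.factor_surjective _)
end

section
/- Let 𝓞 be the ring of integers of a number field, P a nonzero prime ideal of 𝓞, p the rational prime lying below P, and m ≥ 1 an integer. Then the quotient group E(P^m)/E(P^{m+1}) is an elementary abelian p-group of order N(P)³, i.e. it is abelian of cardinality N(P)³ and every element has order dividing p. -/
open NumberField Matrix

variable (K : Type*) [Field K] [NumberField K]

/-- The elementary matrix `T_x = [[1, x], [0, 1]]` in `SL(2, 𝓞)`. -/
def T (x : 𝓞 K) : Matrix.SpecialLinearGroup (Fin 2) (𝓞 K) :=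
  ⟨!![1, x; 0, 1], by simp [Matrix.det_fin_two_of]⟩

/-- The matrix `S = [[0, 1], [-1, 0]]` in `SL(2, 𝓞)`. -/
def S : Matrix.SpecialLinearGroup (Fin 2) (𝓞 K) :=
  ⟨!![0, 1; -1, 0], by simp [Matrix.det_fin_two_of]⟩

/-- `E` is the subgroup of `SL(2, 𝓞)` generated by `S` and all `T_x`, `x ∈ 𝓞`. -/
def E : Subgroup (Matrix.SpecialLinearGroup (Fin 2) (𝓞 K)) :=
  Subgroup.closure ({S K} ∪ Set.range (T K))

/-- The reduction homomorphism `SL(2, 𝓞) → SL(2, 𝓞/π)`. -/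
def red (π : Ideal (𝓞 K)) :
    Matrix.SpecialLinearGroup (Fin 2) (𝓞 K) →*
      Matrix.SpecialLinearGroup (Fin 2) ((𝓞 K) ⧸ π) :=
  Matrix.SpecialLinearGroup.map (Ideal.Quotient.mk π)

/-- The principal congruence subgroup `Γ(π)`, the kernel of reduction mod `π`. -/
def Gamma (π : Ideal (𝓞 K)) : Subgroup (Matrix.SpecialLinearGroup (Fin 2) (𝓞 K)) :=
  MonoidHom.ker (red K π)

instance (π : Ideal (𝓞 K)) : (Gamma K π).Normal := MonoidHom.normal_ker (red K π)

instance (π : Ideal (𝓞 K)) (H : Subgroup (Matrix.SpecialLinearGroup (Fin 2) (𝓞 K))) :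
    ((Gamma K π).subgroupOf H).Normal := Subgroup.normal_subgroupOf

set_option synthInstance.maxHeartbeats 1000000

section Coordinates

variable {K}

omit [NumberField K]

lemma mem_Gamma_iff {I : Ideal (𝓞 K)} {A : Matrix.SpecialLinearGroup (Fin 2) (𝓞 K)} :
    A ∈ Gamma K I ↔ A 0 0 - 1 ∈ I ∧ A 0 1 ∈ I ∧ A 1 0 ∈ I ∧ A 1 1 - 1 ∈ I := by
  have h1 (x : 𝓞 K) : x - 1 ∈ I ↔ Ideal.Quotient.mk I x = 1 := by
    rw [← map_one (Ideal.Quotient.mk I), Ideal.Quotient.mk_eq_mk_iff_sub_mem]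
  simp only [h1, ← Ideal.Quotient.eq_zero_iff_mem]
  simp [Gamma, red, MonoidHom.mem_ker, Matrix.SpecialLinearGroup.ext_iff, Fin.forall_fin_two,
    and_assoc]

/-- The additive group `I / J`, where the ideal `J` is intersected with `I`. -/
abbrev IdealLayer {R : Type*} [CommRing R] (I J : Ideal R) : Type _ :=
  ↥(I.toAddSubgroup) ⧸ J.toAddSubgroup.addSubgroupOf I.toAddSubgroup

/-- The class of an element of `I` in `I / J`. -/
def IdealLayer.mk {R : Type*} [CommRing R] (I J : Ideal R) (x : R) (hx : x ∈ I) : IdealLayer I J :=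
  QuotientAddGroup.mk (⟨x, hx⟩ : I.toAddSubgroup)

namespace IdealLayer

variable {R : Type*} [CommRing R] {I J : Ideal R}

lemma mk_eq_mk_iff {x y : R} (hx : x ∈ I) (hy : y ∈ I) :
    mk I J x hx = mk I J y hy ↔ x - y ∈ J := by
  rw [mk, mk, eq_comm, QuotientAddGroup.eq, AddSubgroup.mem_addSubgroupOf]
  simp [neg_add_eq_sub]

lemma mk_add {x y : R} (hx : x ∈ I) (hy : y ∈ I) :
    mk I J x hx + mk I J y hy = mk I J (x + y) (I.add_mem hx hy) := rfl

lemma mk_eq_zero_iff {x : R} (hx : x ∈ I) : mk I J x hx = 0 ↔ x ∈ J := by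
  rw [show (0 : IdealLayer I J) = mk I J 0 I.zero_mem from rfl, mk_eq_mk_iff, sub_zero]

lemma exists_mk_eq (z : IdealLayer I J) : ∃ x, ∃ hx : x ∈ I, mk I J x hx = z := by
  induction z using QuotientAddGroup.induction_on with
  | H z => exact ⟨z.1, z.2, rfl⟩

lemma nsmul_eq_zero {n : ℕ} (hn : ∀ x ∈ I, (n : R) * x ∈ J) (z : IdealLayer I J) :
    n • z = 0 := by
  obtain ⟨x, hx, rfl⟩ := exists_mk_eq z
  have h : n • mk I J x hx = mk I J (n • x) (I.nsmul_mem hx n) := rfl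
  rw [h, mk_eq_zero_iff, nsmul_eq_mul]
  exact hn x hx

end IdealLayer

variable {I J : Ideal (𝓞 K)}

/-- For `I * I ≤ J`, the homomorphism `1 + X ↦ (X₀₀, X₀₁, X₁₀) mod J` on `H ∩ Γ(I)`. -/
def layerHom (H : Subgroup (Matrix.SpecialLinearGroup (Fin 2) (𝓞 K))) (hIJ : I * I ≤ J) :
    (H ⊓ Gamma K I : Subgroup _) →*
      Multiplicative (IdealLayer I J × IdealLayer I J × IdealLayer I J) :=
  MonoidHom.mk' (fun A => Multiplicative.ofAdd
      (IdealLayer.mk I J (A.1 0 0 - 1) (mem_Gamma_iff.mp A.2.2).1,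
        IdealLayer.mk I J (A.1 0 1) (mem_Gamma_iff.mp A.2.2).2.1,
        IdealLayer.mk I J (A.1 1 0) (mem_Gamma_iff.mp A.2.2).2.2.1)) <| by
    rintro ⟨A, hA⟩ ⟨B, hB⟩
    obtain ⟨a, b, c, d⟩ := mem_Gamma_iff.mp hA.2
    obtain ⟨a', b', c', d'⟩ := mem_Gamma_iff.mp hB.2
    have key {x y : 𝓞 K} (hx : x ∈ I) (hy : y ∈ I) : x * y ∈ J := hIJ (Ideal.mul_mem_mul hx hy)
    rw [← ofAdd_add, Prod.mk_add_mk, Prod.mk_add_mk]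
    simp only [IdealLayer.mk_add]
    refine congrArg _ (Prod.ext ?_ (Prod.ext ?_ ?_)) <;>
      simp only [IdealLayer.mk_eq_mk_iff, Subgroup.coe_mul, Matrix.SpecialLinearGroup.coe_mul,
        Matrix.mul_apply, Fin.sum_univ_two]
    · convert J.add_mem (key a a') (key b c') using 1; ring
    · convert J.add_mem (key a b') (key b d') using 1; ring
    · convert J.add_mem (key c a') (key d c') using 1; ring

variable (H : Subgroup (Matrix.SpecialLinearGroup (Fin 2) (𝓞 K)))

lemma layerHom_apply (hIJ : I * I ≤ J) (A : (H ⊓ Gamma K I : Subgroup _)) :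
    layerHom H hIJ A = Multiplicative.ofAdd
      (IdealLayer.mk I J (A.1 0 0 - 1) (mem_Gamma_iff.mp A.2.2).1,
        IdealLayer.mk I J (A.1 0 1) (mem_Gamma_iff.mp A.2.2).2.1,
        IdealLayer.mk I J (A.1 1 0) (mem_Gamma_iff.mp A.2.2).2.2.1) := rfl

lemma ker_layerHom (hIJ : I * I ≤ J) :
    (layerHom H hIJ).ker = (Gamma K J).subgroupOf (H ⊓ Gamma K I) := by
  ext ⟨A, hA⟩
  obtain ⟨a, b, c, d⟩ := mem_Gamma_iff.mp hA.2
  rw [MonoidHom.mem_ker, layerHom_apply, ofAdd_eq_one, Prod.mk_eq_zero, Prod.mk_eq_zero,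
    IdealLayer.mk_eq_zero_iff, IdealLayer.mk_eq_zero_iff, IdealLayer.mk_eq_zero_iff,
    Subgroup.mem_subgroupOf, mem_Gamma_iff]
  refine ⟨fun ⟨h1, h2, h3⟩ => ⟨h1, h2, h3, ?_⟩, fun h => ⟨h.1, h.2.1, h.2.2.1⟩⟩
  have hdet := A.det_coe
  rw [Matrix.det_fin_two] at hdet
  have had : (A 0 0 - 1) * (A 1 1 - 1) ∈ J := hIJ (Ideal.mul_mem_mul a d)
  convert J.sub_mem (J.sub_mem (J.mul_mem_right (A 1 0) h2) had) h1 using 1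
  linear_combination hdet

lemma coe_T (x : 𝓞 K) : (T K x : Matrix (Fin 2) (Fin 2) (𝓞 K)) = !![1, x; 0, 1] := rfl

lemma coe_S : (S K : Matrix (Fin 2) (Fin 2) (𝓞 K)) = !![0, 1; -1, 0] := rfl

lemma coe_S_conj_T (x : 𝓞 K) :
    ((S K * T K (-x) * (S K)⁻¹ : Matrix.SpecialLinearGroup (Fin 2) (𝓞 K)) :
      Matrix (Fin 2) (Fin 2) (𝓞 K)) = !![1, 0; x, 1] := by
  simp [coe_T, coe_S, Matrix.adjugate_fin_two]

lemma coe_T_one_conj (x : 𝓞 K) :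
    ((T K 1 * (S K * T K (-x) * (S K)⁻¹) * (T K 1)⁻¹ :
      Matrix.SpecialLinearGroup (Fin 2) (𝓞 K)) : Matrix (Fin 2) (Fin 2) (𝓞 K)) =
      !![1 + x, -x; x, 1 - x] := by
  rw [Matrix.SpecialLinearGroup.coe_mul, Matrix.SpecialLinearGroup.coe_mul, coe_S_conj_T,
    Matrix.SpecialLinearGroup.coe_inv, coe_T, Matrix.adjugate_fin_two]
  simp [sub_eq_neg_add]

lemma T_mem_E (x : 𝓞 K) : T K x ∈ E K :=
  Subgroup.subset_closure (Or.inr ⟨x, rfl⟩)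

lemma S_mem_E : S K ∈ E K :=
  Subgroup.subset_closure (Or.inl rfl)

lemma T_mem_Gamma {x : 𝓞 K} (hx : x ∈ I) : T K x ∈ Gamma K I :=
  mem_Gamma_iff.mpr (by simp [coe_T, hx])

lemma conj_mem_E_inf_Gamma {g A : Matrix.SpecialLinearGroup (Fin 2) (𝓞 K)} (hg : g ∈ E K)
    (hA : A ∈ E K ⊓ Gamma K I) : g * A * g⁻¹ ∈ E K ⊓ Gamma K I :=
  ⟨(E K).mul_mem ((E K).mul_mem hg hA.1) ((E K).inv_mem hg),
    Subgroup.Normal.conj_mem inferInstance _ hA.2 _⟩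

lemma layerHom_E_surjective (hIJ : I * I ≤ J) : Function.Surjective (layerHom (E K) hIJ) := by
  intro z
  obtain ⟨⟨z₁, z₂, z₃⟩, rfl⟩ := Multiplicative.ofAdd.surjective z
  obtain ⟨a, ha, rfl⟩ := IdealLayer.exists_mk_eq z₁
  obtain ⟨b, hb, rfl⟩ := IdealLayer.exists_mk_eq z₂
  obtain ⟨c, hc, rfl⟩ := IdealLayer.exists_mk_eq z₃
  have hT {x : 𝓞 K} (hx : x ∈ I) : T K x ∈ E K ⊓ Gamma K I := ⟨T_mem_E x, T_mem_Gamma hx⟩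
  have hL {x : 𝓞 K} (hx : x ∈ I) : S K * T K (-x) * (S K)⁻¹ ∈ E K ⊓ Gamma K I :=
    conj_mem_E_inf_Gamma S_mem_E (hT (I.neg_mem hx))
  let U : (E K ⊓ Gamma K I : Subgroup _) :=
    ⟨_, conj_mem_E_inf_Gamma (T_mem_E 1) (hL ha)⟩
  refine ⟨U * ⟨_, hT (I.add_mem hb ha)⟩ * ⟨_, hL (I.sub_mem hc ha)⟩, ?_⟩
  rw [map_mul, map_mul, layerHom_apply, layerHom_apply, layerHom_apply, ← ofAdd_add, ← ofAdd_add,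
    Prod.mk_add_mk, Prod.mk_add_mk, Prod.mk_add_mk, Prod.mk_add_mk]
  simp only [IdealLayer.mk_add]
  refine congrArg _ (Prod.ext ?_ (Prod.ext ?_ ?_)) <;>
    simp [U, coe_T, coe_S_conj_T, coe_T_one_conj,
      -Matrix.SpecialLinearGroup.coe_mul, -neg_sub]

end Coordinates

lemma IdealLayer.card_pow_succ {P : Ideal (𝓞 K)} (hP : P ≠ ⊥) (m : ℕ) :
    Nat.card (IdealLayer (P ^ m) (P ^ (m + 1))) = Ideal.absNorm P := by
  have h := AddSubgroup.relIndex_mul_index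
    (show (P ^ (m + 1)).toAddSubgroup ≤ (P ^ m).toAddSubgroup from
      Ideal.pow_le_pow_right m.le_succ)
  have e (n : ℕ) : (P ^ n).toAddSubgroup.index = Ideal.absNorm P ^ n := by
    rw [← map_pow]; rfl
  rw [e, e, pow_succ' (Ideal.absNorm P)] at h
  exact Nat.eq_of_mul_eq_mul_right
    (pow_pos (Nat.pos_of_ne_zero (mt Ideal.absNorm_eq_zero_iff.mp hP)) m) h

/-- **Lemma 2.4.** Let `P` be a nonzero prime ideal of `𝓞`, `p` the rational prime below `P`,
and `m ≥ 1`.  Then the quotient `E(P^m)/E(P^{m+1})` is an elementary abelian `p`-group of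
order `N(P)³`: it is abelian, has cardinality `N(P)³`, and every element has order dividing
`p`.  Here `E(π) = E ∩ Γ(π)` and `E(P^{m+1})` is viewed as a subgroup of `E(P^m)` via
`subgroupOf`. -/
theorem E_congruence_quotient_elementary_abelian
    (P : Ideal (𝓞 K)) (hP : P ≠ ⊥) (hprime : P.IsPrime)
    (p : ℕ) (hp : p.Prime) (hpP : (p : 𝓞 K) ∈ P)
    (m : ℕ) (hm : 1 ≤ m) :
    (∀ a b : (E K ⊓ Gamma K (P ^ m) : Subgroup _) ⧸
        ((Gamma K (P ^ (m + 1))).subgroupOf (E K ⊓ Gamma K (P ^ m))), a * b = b * a) ∧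
      Nat.card ((E K ⊓ Gamma K (P ^ m) : Subgroup _) ⧸
        ((Gamma K (P ^ (m + 1))).subgroupOf (E K ⊓ Gamma K (P ^ m)))) =
        Ideal.absNorm P ^ 3 ∧
      (∀ a : (E K ⊓ Gamma K (P ^ m) : Subgroup _) ⧸
        ((Gamma K (P ^ (m + 1))).subgroupOf (E K ⊓ Gamma K (P ^ m))), a ^ p = 1) := by
  have hIJ : P ^ m * P ^ m ≤ P ^ (m + 1) := by
    rw [← pow_add]
    exact Ideal.pow_le_pow_right (by omega)
  let e := (QuotientGroup.quotientMulEquivOfEq (ker_layerHom (E K) hIJ).symm).trans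
    (QuotientGroup.quotientKerEquivOfSurjective _ (layerHom_E_surjective hIJ))
  refine ⟨fun a b => e.injective ?_, ?_, fun a => e.injective ?_⟩
  · rw [map_mul, map_mul, mul_comm]
  · rw [Nat.card_congr (e.toEquiv.trans Multiplicative.toAdd), Nat.card_prod, Nat.card_prod,
      IdealLayer.card_pow_succ K hP]
    ring
  · have hsmul (z : IdealLayer (P ^ m) (P ^ (m + 1))) : p • z = 0 :=
      IdealLayer.nsmul_eq_zero
        (fun x hx => by rw [pow_succ']; exact Ideal.mul_mem_mul hpP hx) z
    rw [map_pow, map_one]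
    apply Multiplicative.toAdd.injective
    rw [toAdd_pow, toAdd_one]
    exact Prod.ext (hsmul _) (Prod.ext (hsmul _) (hsmul _))
end

section
/- Let 𝓞 be the ring of integers of a number field, G = PSL(2,𝓞), and let H be a finite-index subgroup of G of level m. Then H is a congruence subgroup of G if and only if Ḡ(m𝓞) ⊆ H. -/
set_option linter.unusedSectionVars false

open NumberField Matrix

instance : Fact (Even (Fintype.card (Fin 2))) := ⟨⟨1, rfl⟩⟩

variable (K : Type*) [Field K] [NumberField K]

/-- The subgroup `{±I}` of `SL(2, 𝓞)`, generated by `-I`. -/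
def PM : Subgroup (Matrix.SpecialLinearGroup (Fin 2) (𝓞 K)) :=
  Subgroup.closure {(-1 : Matrix.SpecialLinearGroup (Fin 2) (𝓞 K))}

theorem PM_le_center : PM K ≤ Subgroup.center (Matrix.SpecialLinearGroup (Fin 2) (𝓞 K)) := by
  rw [PM, Subgroup.closure_le]
  rintro x rfl
  rw [SetLike.mem_coe, Subgroup.mem_center_iff]
  intro g
  ext i j
  simp [Matrix.SpecialLinearGroup.coe_mul]

instance PM_normal : (PM K).Normal := by
  constructor
  intro n hn g
  have hc := PM_le_center K hn
  rw [Subgroup.mem_center_iff] at hc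
  rw [hc g, mul_assoc, mul_inv_cancel, mul_one]
  exact hn

/-- `PSL(2, 𝓞)`, the quotient of `SL(2, 𝓞)` by `{±I}`. -/
def PSL := Matrix.SpecialLinearGroup (Fin 2) (𝓞 K) ⧸ PM K

instance : Group (PSL K) := QuotientGroup.Quotient.group (PM K)

/-- The projection `SL(2, 𝓞) → PSL(2, 𝓞)`. -/
def proj : Matrix.SpecialLinearGroup (Fin 2) (𝓞 K) →* PSL K :=
  QuotientGroup.mk' (PM K)

/-- The principal congruence subgroup `Ḡ(π)` of `PSL(2,𝓞)` : the image in `PSL(2,𝓞)` of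
`{A ∈ SL(2,𝓞) : A ≡ ±I (mod π)}`, the set of matrices reducing to `±I` modulo `π`. -/
def Gbar (π : Ideal (𝓞 K)) : Subgroup (PSL K) :=
  Subgroup.map (proj K)
    (Subgroup.comap (red K π)
      (Subgroup.closure {(-1 : Matrix.SpecialLinearGroup (Fin 2) ((𝓞 K) ⧸ π))}))

/-- A subgroup of `G = PSL(2,𝓞)` is a congruence subgroup if it contains `Ḡ(π)` for some
nonzero ideal `π` of `𝓞`. -/
def IsCongruence (H : Subgroup (PSL K)) : Prop :=
  ∃ π : Ideal (𝓞 K), π ≠ ⊥ ∧ Gbar K π ≤ H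

/-- The normal closure in `PSL(2,𝓞)` of the images of the matrices `T_{mx}`, `x ∈ 𝓞`. -/
def TclosureP (m : ℕ) : Subgroup (PSL K) :=
  Subgroup.normalClosure {x : PSL K | ∃ a : 𝓞 K, x = proj K (T K ((m : 𝓞 K) * a))}

/-- `H ≤ PSL(2,𝓞)` has level `m` : `m` is the smallest positive integer such that the
normal closure in `PSL(2,𝓞)` of the images of `{T_{mx} : x ∈ 𝓞}` is contained in `H`. -/
def HasLevelP (H : Subgroup (PSL K)) (m : ℕ) : Prop :=
  0 < m ∧ TclosureP K m ≤ H ∧ ∀ k : ℕ, 0 < k → TclosureP K k ≤ H → m ≤ k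

/-- A commutative ring with finitely many maximal ideals has stable range one. -/
theorem exists_isUnit_add_mul_of_isCoprime {S : Type*} [CommRing S] [Finite (MaximalSpectrum S)]
    {a b : S} (h : IsCoprime a b) : ∃ x : S, IsUnit (a + x * b) := by
  classical
  have hcop : Pairwise fun M N : MaximalSpectrum S => IsCoprime M.asIdeal N.asIdeal := by
    intro M N hMN
    rw [Ideal.isCoprime_iff_sup_eq]
    exact M.isMaximal.coprime_of_ne N.isMaximal fun e => hMN (MaximalSpectrum.ext e)
  obtain ⟨x, hx⟩ := Ideal.exists_forall_sub_mem_ideal hcop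
    fun M => if a ∈ M.asIdeal then (1 : S) else 0
  refine ⟨x, ?_⟩
  by_contra hu
  obtain ⟨M, hM, hmem⟩ := exists_max_ideal_of_mem_nonunits hu
  have hxM := hx ⟨M, hM⟩
  by_cases ha : a ∈ M
  · simp only [ha, if_true] at hxM
    have hb : b ∈ M := by
      have := M.sub_mem (M.sub_mem hmem ha) (M.mul_mem_right b hxM)
      ring_nf at this
      exact this
    obtain ⟨u, v, huv⟩ := h
    exact hM.ne_top ((Ideal.eq_top_iff_one M).2
      (huv ▸ M.add_mem (M.mul_mem_left u ha) (M.mul_mem_left v hb)))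
  · simp only [ha, if_false, sub_zero] at hxM
    have := M.sub_mem hmem (M.mul_mem_right b hxM)
    rw [add_sub_cancel_right] at this
    exact ha this

/-- Two matrices of determinant one with the same first row and column and invertible upper left
entry are equal. -/
theorem SL2_ext_of_isUnit {S : Type*} [CommRing S] {A B : Matrix.SpecialLinearGroup (Fin 2) S}
    (hu : IsUnit (A 0 0)) (h00 : A 0 0 = B 0 0) (h01 : A 0 1 = B 0 1) (h10 : A 1 0 = B 1 0) :
    A = B := by
  have hA := A.det_coe
  have hB := B.det_coe
  rw [Matrix.det_fin_two] at hA hB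
  have h11 : A 1 1 = B 1 1 := by
    refine hu.mul_left_cancel ?_
    linear_combination hA - hB - B 1 1 * h00 + A 1 0 * h01 + B 0 1 * h10
  ext i j
  fin_cases i <;> fin_cases j <;> assumption

theorem mem_of_map_eq_of_ker_le {G G' : Type*} [Group G] [Group G'] {f : G →* G'} {H : Subgroup G}
    (hf : f.ker ≤ H) {a b : G} (hb : b ∈ H) (h : f a = f b) : a ∈ H := by
  have hab : a * b⁻¹ ∈ H := hf (by rw [MonoidHom.mem_ker, map_mul, map_inv, h, mul_inv_cancel])
  simpa using H.mul_mem hab hb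

section Wohlfahrt

variable {R : Type*} [CommRing R]

/-- The elementary matrix `[[1, x], [0, 1]]`. -/
def upperUnipotent (x : R) : Matrix.SpecialLinearGroup (Fin 2) R :=
  ⟨!![1, x; 0, 1], by simp [Matrix.det_fin_two_of]⟩

/-- The elementary matrix `[[1, 0], [x, 1]]`. -/
def lowerUnipotent (x : R) : Matrix.SpecialLinearGroup (Fin 2) R :=
  ⟨!![1, 0; x, 1], by simp [Matrix.det_fin_two_of]⟩

theorem coe_upperUnipotent (x : R) :
    (upperUnipotent x : Matrix (Fin 2) (Fin 2) R) = !![1, x; 0, 1] :=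
  rfl

theorem coe_lowerUnipotent (x : R) :
    (lowerUnipotent x : Matrix (Fin 2) (Fin 2) R) = !![1, 0; x, 1] :=
  rfl

variable {H : Subgroup (Matrix.SpecialLinearGroup (Fin 2) R)} {m : R} {I : Ideal R}

theorem lowerUnipotent_mem (hT : ∀ g x, g * upperUnipotent (m * x) * g⁻¹ ∈ H) (x : R) :
    lowerUnipotent (m * x) ∈ H := by
  let S : Matrix.SpecialLinearGroup (Fin 2) R :=
    ⟨!![0, -1; 1, 0], by simp [Matrix.det_fin_two_of]⟩
  have hS : (S : Matrix (Fin 2) (Fin 2) R) = !![0, -1; 1, 0] := rfl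
  convert hT S (-x) using 1
  ext i j
  rw [Matrix.SpecialLinearGroup.coe_mul, Matrix.SpecialLinearGroup.coe_mul,
    Matrix.SpecialLinearGroup.coe_inv, hS, coe_upperUnipotent, coe_lowerUnipotent,
    Matrix.adjugate_fin_two_of, Matrix.mul_fin_two, Matrix.mul_fin_two]
  fin_cases i <;> fin_cases j <;> simp

/-- The special case of `mem_of_map_mk_eq_one` where the upper left entry is invertible
modulo `I`. -/
theorem mem_of_isUnit_mk (hT : ∀ g x, g * upperUnipotent (m * x) * g⁻¹ ∈ H)
    (hI : (Matrix.SpecialLinearGroup.map (Ideal.Quotient.mk I)).ker ≤ H)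
    {A : Matrix.SpecialLinearGroup (Fin 2) R} (h00 : m ∣ A 0 0 - 1) (h01 : m ∣ A 0 1)
    (h10 : m ∣ A 1 0) (hu : IsUnit (Ideal.Quotient.mk I (A 0 0))) : A ∈ H := by
  obtain ⟨t, ht⟩ := h00
  obtain ⟨b, hb⟩ := h01
  obtain ⟨c, hc⟩ := h10
  obtain ⟨v', hv'⟩ := hu.exists_right_inv
  obtain ⟨v, rfl⟩ := Ideal.Quotient.mk_surjective v'
  have hT' (x : R) : upperUnipotent (m * x) ∈ H := by simpa using hT 1 x
  let B : Matrix.SpecialLinearGroup (Fin 2) R :=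
    ⟨!![1 + m * t, m * t; -(m * t), 1 - m * t], by rw [Matrix.det_fin_two_of]; ring⟩
  have hB : B ∈ H := by
    have hB' : (B : Matrix (Fin 2) (Fin 2) R) = !![1 + m * t, m * t; -(m * t), 1 - m * t] := rfl
    convert hT (lowerUnipotent (-1)) t using 1
    ext i j
    rw [Matrix.SpecialLinearGroup.coe_mul, Matrix.SpecialLinearGroup.coe_mul,
      Matrix.SpecialLinearGroup.coe_inv, hB', coe_upperUnipotent, coe_lowerUnipotent,
      Matrix.adjugate_fin_two_of, Matrix.mul_fin_two, Matrix.mul_fin_two]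
    fin_cases i <;> fin_cases j <;> simp <;> ring
  have hA00 : A 0 0 = 1 + m * t := by linear_combination ht
  let C := lowerUnipotent (m * (-(c + t) * v)) * A * upperUnipotent (m * ((t - b) * v))
  have hC00 : C 0 0 = A 0 0 := by
    simp [C, coe_upperUnipotent, coe_lowerUnipotent, Matrix.mul_apply, Matrix.vecMul, dotProduct,
      Fin.sum_univ_two]
  have hC01 : C 0 1 = A 0 0 * (m * ((t - b) * v)) + A 0 1 := by
    simp [C, coe_upperUnipotent, coe_lowerUnipotent, Matrix.mul_apply, Matrix.vecMul, dotProduct,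
      Fin.sum_univ_two]
  have hC10 : C 1 0 = m * (-(c + t) * v) * A 0 0 + A 1 0 := by
    simp [C, coe_upperUnipotent, coe_lowerUnipotent, Matrix.mul_apply, Matrix.vecMul, dotProduct,
      Fin.sum_univ_two]
  have hred :
      Matrix.SpecialLinearGroup.map (Ideal.Quotient.mk I) C =
        Matrix.SpecialLinearGroup.map (Ideal.Quotient.mk I) B := by
    refine SL2_ext_of_isUnit ?_ ?_ ?_ ?_
    · change IsUnit (Ideal.Quotient.mk I (C 0 0))
      rwa [hC00]
    · change Ideal.Quotient.mk I (C 0 0) = Ideal.Quotient.mk I (1 + m * t)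
      rw [hC00, hA00]
    · change Ideal.Quotient.mk I (C 0 1) = Ideal.Quotient.mk I (m * t)
      rw [hC01, hb]
      simp only [map_add, map_mul, map_sub]
      linear_combination
        (Ideal.Quotient.mk I m * (Ideal.Quotient.mk I t - Ideal.Quotient.mk I b)) * hv'
    · change Ideal.Quotient.mk I (C 1 0) = Ideal.Quotient.mk I (-(m * t))
      rw [hC10, hc]
      simp only [map_add, map_mul, map_neg]
      linear_combination
        (-Ideal.Quotient.mk I m * (Ideal.Quotient.mk I c + Ideal.Quotient.mk I t)) * hv'
  have hC : C ∈ H := mem_of_map_eq_of_ker_le hI hB hred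
  rwa [H.mul_mem_cancel_right (hT' _), H.mul_mem_cancel_left (lowerUnipotent_mem hT _)] at hC

/-- A subgroup of `SL(2, R)` containing all conjugates of the `[[1, mx], [0, 1]]` and some principal
congruence subgroup contains the principal congruence subgroup modulo `m`. -/
theorem mem_of_map_mk_eq_one (hT : ∀ g x, g * upperUnipotent (m * x) * g⁻¹ ∈ H) [Finite (R ⧸ I)]
    (hI : (Matrix.SpecialLinearGroup.map (Ideal.Quotient.mk I)).ker ≤ H)
    {A : Matrix.SpecialLinearGroup (Fin 2) R}
    (hA : Matrix.SpecialLinearGroup.map (Ideal.Quotient.mk (Ideal.span {m})) A = 1) : A ∈ H := by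
  have hentry (i j : Fin 2) :
      Ideal.Quotient.mk (Ideal.span {m}) (A i j) =
        (1 : Matrix.SpecialLinearGroup (Fin 2) (R ⧸ Ideal.span {m})) i j := by
    rw [← hA]
    rfl
  have h00 : m ∣ A 0 0 - 1 := by
    rw [← Ideal.mem_span_singleton, ← Ideal.Quotient.eq, hentry]
    simp
  have h01 : m ∣ A 0 1 := by
    rw [← Ideal.mem_span_singleton, ← Ideal.Quotient.eq_zero_iff_mem, hentry]
    simp
  have h10 : m ∣ A 1 0 := by
    rw [← Ideal.mem_span_singleton, ← Ideal.Quotient.eq_zero_iff_mem, hentry]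
    simp
  have hcop : IsCoprime (A 0 0) (m * A 1 0) := by
    refine IsCoprime.mul_right ?_ ?_
    · obtain ⟨t, ht⟩ := h00
      exact ⟨1, -t, by linear_combination ht⟩
    · have hdet := A.det_coe
      rw [Matrix.det_fin_two] at hdet
      exact ⟨A 1 1, -A 0 1, by linear_combination hdet⟩
  obtain ⟨x', hx⟩ := exists_isUnit_add_mul_of_isCoprime (hcop.map (Ideal.Quotient.mk I))
  obtain ⟨x, rfl⟩ := Ideal.Quotient.mk_surjective x'
  have hTx : upperUnipotent (m * x) ∈ H := by simpa using hT 1 x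
  rw [← H.mul_mem_cancel_left hTx]
  have e00 : (upperUnipotent (m * x) * A) 0 0 = A 0 0 + m * x * A 1 0 := by
    simp [coe_upperUnipotent, Matrix.mul_apply, Fin.sum_univ_two]
  have e01 : (upperUnipotent (m * x) * A) 0 1 = A 0 1 + m * x * A 1 1 := by
    simp [coe_upperUnipotent, Matrix.mul_apply, Fin.sum_univ_two]
  have e10 : (upperUnipotent (m * x) * A) 1 0 = A 1 0 := by
    simp [coe_upperUnipotent, Matrix.mul_apply, Fin.sum_univ_two]
  refine mem_of_isUnit_mk hT hI ?_ ?_ ?_ ?_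
  · rw [e00, add_sub_right_comm, mul_assoc]
    exact h00.add (dvd_mul_right _ _)
  · rw [e01, mul_assoc]
    exact h01.add (dvd_mul_right _ _)
  · rwa [e10]
  · rw [e00]
    convert hx using 1
    simp only [map_add, map_mul]
    ring

end Wohlfahrt

theorem proj_neg_one : proj K (-1) = 1 :=
  (QuotientGroup.eq_one_iff _).2 (Subgroup.subset_closure rfl)

theorem ker_red_le_comap_Gbar (I : Ideal (𝓞 K)) :
    (red K I).ker ≤ (Gbar K I).comap (proj K) := by
  intro A hA
  refine Subgroup.mem_map_of_mem _ ?_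
  rw [Subgroup.mem_comap, MonoidHom.mem_ker.1 hA]
  exact one_mem _

/-- `Ḡ(I)` is the image of the matrices congruent to the identity modulo `I`. -/
theorem Gbar_eq_map_ker (I : Ideal (𝓞 K)) : Gbar K I = (red K I).ker.map (proj K) := by
  refine le_antisymm ?_ (Subgroup.map_le_iff_le_comap.2 (ker_red_le_comap_Gbar K I))
  have hneg : red K I (-1) = -1 := by
    ext i j
    fin_cases i <;> fin_cases j <;> simp [red]
  rw [Gbar, ← hneg, ← Set.image_singleton, ← MonoidHom.map_closure, Subgroup.comap_map_eq,
    Subgroup.map_sup, sup_le_iff]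
  refine ⟨?_, le_rfl⟩
  rw [MonoidHom.map_closure, Set.image_singleton, proj_neg_one, Subgroup.closure_singleton_one]
  exact bot_le

/-- **Theorem 3.6 (Wohlfahrt's theorem for `PSL(2,𝓞)`).** Let `H` be a finite-index
subgroup of `G = PSL(2,𝓞)` of level `m`.  Then `H` is a congruence subgroup of `G` iff
`Ḡ(m𝓞) ⊆ H`. -/
theorem wohlfahrt_PSL (H : Subgroup (PSL K)) (hfin : H.FiniteIndex) (m : ℕ)
    (hlevel : HasLevelP K H m) :
    IsCongruence K H ↔ Gbar K (Ideal.span {(m : 𝓞 K)}) ≤ H := by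
  constructor
  · rintro ⟨I, hI0, hI⟩
    rw [Gbar_eq_map_ker, Subgroup.map_le_iff_le_comap]
    intro A hA
    have : Finite (𝓞 K ⧸ I) := Ideal.finiteQuotientOfFreeOfNeBot I hI0
    refine mem_of_map_mk_eq_one (I := I) (fun g x => ?_)
      ((ker_red_le_comap_Gbar K I).trans (Subgroup.comap_mono hI)) (MonoidHom.mem_ker.1 hA)
    rw [Subgroup.mem_comap, map_mul, map_mul, map_inv]
    have hx : proj K (T K (m * x)) ∈ TclosureP K m := Subgroup.subset_normalClosure ⟨x, rfl⟩
    exact hlevel.2.1 (Subgroup.normalClosure_normal.conj_mem _ hx _)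
  · intro h
    refine ⟨_, ?_, h⟩
    rw [Ne, Ideal.span_singleton_eq_bot]
    exact_mod_cast hlevel.1.ne'
end
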